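/- Let ρ be a density matrix on ℂ^N with ascending eigenvalues λ_1^↑ ≤ λ_2^↑ ≤ … ≤ λ_N^↑, and let 0 ≤ ε < 1. Let k be the largest integer j with 0 ≤ j ≤ N such that ∑_{i=1}^{j} λ_i^↑ ≤ ε. Then the minimum of rank(σ) over all density matrices σ ∈ B^ε(ρ) equals N − k; equivalently, S_0^ε(ρ) = log₂(N − k). -/

import Mathlib

open Matrix
open scoped ComplexOrder
open Classical in
/-- The eigenvalues of a (Hermitian) matrix, listed in ascending order with
multiplicity; junk value `0` for non-Hermitian matrices. -/
noncomputable def eigAsc {N : ℕ} (A : Matrix (Fin N) (Fin N) ℂ) : Fin N → ℝ :=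
  if h : A.IsHermitian then fun i => h.eigenvalues (Tuple.sort h.eigenvalues i)
  else fun _ => 0

/-- The trace distance `‖A‖ = (1/2) ∑ᵢ |λᵢ^↑(A)|` (applied to `A = ρ - σ`). -/
noncomputable def trDist {N : ℕ} (A : Matrix (Fin N) (Fin N) ℂ) : ℝ :=
  (1 / 2) * ∑ i, |eigAsc A i|

/-- A density matrix: positive semidefinite with trace 1. -/
def IsDensity {N : ℕ} (ρ : Matrix (Fin N) (Fin N) ℂ) : Prop :=
  ρ.PosSemidef ∧ ρ.trace = 1

/-- Spectral decomposition with ascending eigenvalues. -/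
lemma eigAsc_spectral {N : ℕ} {A : Matrix (Fin N) (Fin N) ℂ} (hA : A.IsHermitian) :
    ∃ U : Matrix (Fin N) (Fin N) ℂ, U * Uᴴ = 1 ∧ Uᴴ * U = 1 ∧
      A = U * diagonal (fun i => (eigAsc A i : ℂ)) * Uᴴ := by
  classical
  have hs := hA.spectral_theorem
  rw [Unitary.conjStarAlgAut_apply] at hs
  set V : Matrix (Fin N) (Fin N) ℂ := (hA.eigenvectorUnitary : Matrix (Fin N) (Fin N) ℂ) with hV
  have h1 : V * Vᴴ = 1 := Unitary.coe_mul_star_self hA.eigenvectorUnitary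
  have h2 : Vᴴ * V = 1 := Unitary.coe_star_mul_self hA.eigenvectorUnitary
  set π := Tuple.sort hA.eigenvalues with hπ
  have he : (fun i => (eigAsc A i : ℂ)) = (fun i => (hA.eigenvalues i : ℂ)) ∘ π := by
    funext i
    simp [eigAsc, hA, hπ]
  refine ⟨V.submatrix id π, ?_, ?_, ?_⟩
  · rw [conjTranspose_submatrix, submatrix_mul_equiv, h1, submatrix_id_id]
  · rw [conjTranspose_submatrix, ← submatrix_mul _ _ _ id _ Function.bijective_id, h2,
      submatrix_one_equiv]
  · have hd : diagonal (fun i => (eigAsc A i : ℂ)) =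
        (diagonal (fun i => (hA.eigenvalues i : ℂ))).submatrix π π := by
      rw [he, submatrix_diagonal_equiv]
    rw [hd, conjTranspose_submatrix, submatrix_mul_equiv, submatrix_mul_equiv, submatrix_id_id]
    exact hs

lemma eigAsc_mono {N : ℕ} (A : Matrix (Fin N) (Fin N) ℂ) : Monotone (eigAsc A) := by
  unfold eigAsc
  split_ifs with h
  · exact Tuple.monotone_sort h.eigenvalues
  · exact monotone_const

lemma eigAsc_nonneg {N : ℕ} {A : Matrix (Fin N) (Fin N) ℂ} (hA : A.PosSemidef) (i : Fin N) :
    0 ≤ eigAsc A i := by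
  unfold eigAsc
  rw [dif_pos hA.isHermitian]
  exact hA.eigenvalues_nonneg _

lemma trace_conj_diag {N : ℕ} {U : Matrix (Fin N) (Fin N) ℂ} (h : Uᴴ * U = 1) (d : Fin N → ℝ) :
    (U * diagonal (fun i => (d i : ℂ)) * Uᴴ).trace = ((∑ i, d i : ℝ) : ℂ) := by
  rw [trace_mul_comm, ← mul_assoc, h, one_mul, trace_diagonal]
  push_cast
  rfl

lemma rank_conj_diag {N : ℕ} {U : Matrix (Fin N) (Fin N) ℂ} (h : Uᴴ * U = 1) (d : Fin N → ℝ) :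
    (U * diagonal (fun i => (d i : ℂ)) * Uᴴ).rank = (Finset.univ.filter (fun i => d i ≠ 0)).card := by
  classical
  have h' : U * Uᴴ = 1 := mul_eq_one_comm.mp h
  have u1 : IsUnit U.det := by
    rw [← isUnit_iff_isUnit_det]; exact IsUnit.of_mul_eq_one _ h'
  have u2 : IsUnit Uᴴ.det := by
    rw [← isUnit_iff_isUnit_det]; exact IsUnit.of_mul_eq_one _ h
  rw [rank_mul_eq_left_of_isUnit_det _ _ u2, rank_mul_eq_right_of_isUnit_det _ _ u1,
    rank_diagonal, Fintype.card_subtype]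
  simp

/-- Diagonal entries in another orthonormal basis are doubly stochastic averages. -/
lemma diag_stoch {N : ℕ} {U V : Matrix (Fin N) (Fin N) ℂ}
    (hU : Uᴴ * U = 1) (hV : Vᴴ * V = 1) :
    ∃ P : Fin N → Fin N → ℝ, (∀ a b, 0 ≤ P a b) ∧ (∀ a, ∑ b, P a b = 1) ∧
      (∀ b, ∑ a, P a b = 1) ∧
      ∀ (d : Fin N → ℝ) (a : Fin N),
        (Vᴴ * (U * diagonal (fun i => (d i : ℂ)) * Uᴴ) * V) a a = ((∑ b, P a b * d b : ℝ) : ℂ) := by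
  have hU' : U * Uᴴ = 1 := mul_eq_one_comm.mp hU
  have hV' : V * Vᴴ = 1 := mul_eq_one_comm.mp hV
  set W := Vᴴ * U with hW
  have w1 : W * Wᴴ = 1 := by
    rw [hW, conjTranspose_mul, conjTranspose_conjTranspose, mul_assoc, ← mul_assoc U, hU', one_mul, hV]
  have w2 : Wᴴ * W = 1 := mul_eq_one_comm.mp w1
  refine ⟨fun a b => Complex.normSq (W a b), fun a b => Complex.normSq_nonneg _, ?_, ?_, ?_⟩
  · intro a
    have := congrFun (congrFun w1 a) a
    rw [mul_apply, one_apply_eq] at this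
    apply Complex.ofReal_injective
    push_cast
    rw [← this]
    refine Finset.sum_congr rfl fun b _ => ?_
    rw [conjTranspose_apply, Complex.normSq_eq_conj_mul_self, mul_comm]
    rfl
  · intro b
    have := congrFun (congrFun w2 b) b
    rw [mul_apply, one_apply_eq] at this
    apply Complex.ofReal_injective
    push_cast
    rw [← this]
    refine Finset.sum_congr rfl fun a _ => ?_
    rw [conjTranspose_apply, Complex.normSq_eq_conj_mul_self]
    rfl
  · intro d a
    have : Vᴴ * (U * diagonal (fun i => (d i : ℂ)) * Uᴴ) * V
        = W * diagonal (fun i => (d i : ℂ)) * Wᴴ := by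
      rw [hW, conjTranspose_mul, conjTranspose_conjTranspose]
      simp only [mul_assoc]
    rw [this, mul_apply]
    push_cast
    refine Finset.sum_congr rfl fun b _ => ?_
    rw [mul_diagonal, conjTranspose_apply, Complex.normSq_eq_conj_mul_self]
    simp only [RCLike.star_def]
    ring

lemma conj_cancel {N : ℕ} {V : Matrix (Fin N) (Fin N) ℂ} (hV : Vᴴ * V = 1)
    (D : Matrix (Fin N) (Fin N) ℂ) : Vᴴ * (V * D * Vᴴ) * V = D := by
  calc Vᴴ * (V * D * Vᴴ) * V = (Vᴴ * V) * D * (Vᴴ * V) := by simp only [mul_assoc]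
    _ = D := by rw [hV, one_mul, mul_one]

/-- Trace distance is at most the one computed from any diagonalization. -/
lemma trDist_le {N : ℕ} {U : Matrix (Fin N) (Fin N) ℂ} (hU : Uᴴ * U = 1) (d : Fin N → ℝ) :
    trDist (U * diagonal (fun i => (d i : ℂ)) * Uᴴ) ≤ (1 / 2) * ∑ i, |d i| := by
  set A := U * diagonal (fun i => (d i : ℂ)) * Uᴴ with hA
  have hH : A.IsHermitian := by
    rw [hA]
    apply isHermitian_mul_mul_conjTranspose
    rw [IsHermitian, diagonal_conjTranspose]
    congr 1
    funext i
    simp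
  obtain ⟨V, -, hV, hs⟩ := eigAsc_spectral hH
  obtain ⟨P, p0, p1, p2, p3⟩ := diag_stoch hU hV
  have key : ∀ a, eigAsc A a = ∑ b, P a b * d b := by
    intro a
    have := p3 d a
    rw [← hA] at this
    conv_lhs at this => rw [hs]
    rw [conj_cancel hV, diagonal_apply_eq] at this
    exact Complex.ofReal_injective this
  unfold trDist
  refine mul_le_mul_of_nonneg_left ?_ (by norm_num)
  calc ∑ a, |eigAsc A a| ≤ ∑ a, ∑ b, P a b * |d b| := by
        refine Finset.sum_le_sum fun a _ => ?_
        rw [key a]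
        refine (Finset.abs_sum_le_sum_abs _ _).trans (le_of_eq ?_)
        refine Finset.sum_congr rfl fun b _ => ?_
        rw [abs_mul, abs_of_nonneg (p0 a b)]
    _ = ∑ b, |d b| := by
        rw [Finset.sum_comm]
        refine Finset.sum_congr rfl fun b _ => ?_
        rw [← Finset.sum_mul, p2, one_mul]

/-- Weighted sums of a monotone sequence dominate the sum of the smallest terms. -/
lemma kyfan {N : ℕ} (f w : Fin N → ℝ) (hf : Monotone f) (w0 : ∀ i, 0 ≤ w i) (w1 : ∀ i, w i ≤ 1)
    (j : ℕ) (hj : j ≤ N) (hw : ∑ i, w i = j) :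
    (∑ i : Fin N, if (i : ℕ) < j then f i else 0) ≤ ∑ i, w i * f i := by
  rcases Nat.eq_zero_or_pos j with h0 | hpos
  · subst h0
    have : ∀ i ∈ Finset.univ, w i = 0 := by
      rw [← Finset.sum_eq_zero_iff_of_nonneg (fun i _ => w0 i)]
      simpa using hw
    simp [this]
  · set c := f ⟨j - 1, by omega⟩ with hc
    have hcard : (∑ i : Fin N, if (i : ℕ) < j then (1 : ℝ) else 0) = j := by
      rw [Fin.sum_univ_eq_sum_range (fun i => if i < j then (1 : ℝ) else 0) N,
        ← Finset.sum_filter]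
      have : (Finset.range N).filter (· < j) = Finset.range j := by
        ext x; simp; omega
      rw [this]; simp
    have h : ∀ i ∈ (Finset.univ : Finset (Fin N)), (if (i : ℕ) < j then f i else 0)
        ≤ w i * f i - c * (w i - (if (i : ℕ) < j then (1 : ℝ) else 0)) := by
      intro i _
      split_ifs with hi
      · have : f i ≤ c := hf (by rw [Fin.le_def]; simp; omega)
        nlinarith [w1 i]
      · have : c ≤ f i := hf (by rw [Fin.le_def]; simp; omega)
        nlinarith [w0 i]
    refine (Finset.sum_le_sum h).trans (le_of_eq ?_)
    rw [Finset.sum_sub_distrib, ← Finset.mul_sum, Finset.sum_sub_distrib, hw, hcard]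
    ring

lemma sum_eigAsc {N : ℕ} {A : Matrix (Fin N) (Fin N) ℂ} (hA : A.IsHermitian) :
    A.trace = ((∑ i, eigAsc A i : ℝ) : ℂ) := by
  obtain ⟨V, -, hV, hs⟩ := eigAsc_spectral hA
  conv_lhs => rw [hs]
  exact trace_conj_diag hV _

lemma rank_lower {N : ℕ} {ρ σ : Matrix (Fin N) (Fin N) ℂ} (hρ : IsDensity ρ) (hσ : IsDensity σ) :
    (∑ i : Fin N, if (i : ℕ) < N - σ.rank then eigAsc ρ i else 0) ≤ trDist (ρ - σ) := by
  classical
  have hX : (ρ - σ).IsHermitian := hρ.1.isHermitian.sub hσ.1.isHermitian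
  obtain ⟨U, -, hU, hUs⟩ := eigAsc_spectral hρ.1.isHermitian
  obtain ⟨V, -, hV, hVs⟩ := eigAsc_spectral hσ.1.isHermitian
  obtain ⟨X, -, hXu, hXs⟩ := eigAsc_spectral hX
  set Z := Finset.univ.filter (fun i => eigAsc σ i = 0) with hZ
  have hrank : σ.rank = (Finset.univ.filter (fun i => eigAsc σ i ≠ 0)).card := by
    conv_lhs => rw [hVs]
    exact rank_conj_diag hV _
  have hcard : Z.card + σ.rank = N := by
    rw [hrank, hZ, Finset.card_filter_add_card_filter_not]
    simp
  have hj : N - σ.rank = Z.card := by omega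
  have htr : ∑ i, eigAsc (ρ - σ) i = 0 := by
    have := sum_eigAsc hX
    rw [trace_sub, hρ.2, hσ.2, sub_self] at this
    exact_mod_cast this.symm
  obtain ⟨P, p0, p1, p2, p3⟩ := diag_stoch hU hV
  obtain ⟨Q, q0, q1, q2, q3⟩ := diag_stoch hXu hV
  have e : ∀ a ∈ Z, ∑ b, P a b * eigAsc ρ b = ∑ b, Q a b * eigAsc (ρ - σ) b := by
    intro a ha
    have h1 := p3 (eigAsc ρ) a
    rw [← hUs] at h1
    have h2 := q3 (eigAsc (ρ - σ)) a
    rw [← hXs] at h2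
    have h3 : (Vᴴ * σ * V) a a = 0 := by
      rw [hVs, conj_cancel hV, diagonal_apply_eq, (Finset.mem_filter.mp ha).2]
      simp
    rw [mul_sub, sub_mul, Matrix.sub_apply, h3, sub_zero, h1] at h2
    exact Complex.ofReal_injective h2
  have sub1 : ∀ (R : Fin N → Fin N → ℝ), (∀ a b, 0 ≤ R a b) → (∀ b, ∑ a, R a b = 1) →
      ∀ b, ∑ a ∈ Z, R a b ≤ 1 := by
    intro R r0 r2 b
    rw [← r2 b]
    exact Finset.sum_le_sum_of_subset_of_nonneg (Finset.subset_univ _) (fun a _ _ => r0 a b)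
  rw [hj]
  calc (∑ i : Fin N, if (i : ℕ) < Z.card then eigAsc ρ i else 0)
      ≤ ∑ b, (∑ a ∈ Z, P a b) * eigAsc ρ b := by
        refine kyfan _ _ (eigAsc_mono ρ) (fun b => Finset.sum_nonneg fun a _ => p0 a b)
          (sub1 P p0 p2) _ (by omega) ?_
        rw [Finset.sum_comm]
        simp [p1]
    _ = ∑ a ∈ Z, ∑ b, P a b * eigAsc ρ b := by
        rw [Finset.sum_comm]
        simp only [Finset.sum_mul]
    _ = ∑ a ∈ Z, ∑ b, Q a b * eigAsc (ρ - σ) b := Finset.sum_congr rfl e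
    _ = ∑ b, (∑ a ∈ Z, Q a b) * eigAsc (ρ - σ) b := by
        rw [Finset.sum_comm]
        simp only [Finset.sum_mul]
    _ ≤ ∑ b, (1 / 2) * (|eigAsc (ρ - σ) b| + eigAsc (ρ - σ) b) := by
        refine Finset.sum_le_sum fun b _ => ?_
        have h1 := sub1 Q q0 q2 b
        have h0 : 0 ≤ ∑ a ∈ Z, Q a b := Finset.sum_nonneg fun a _ => q0 a b
        rcases le_total 0 (eigAsc (ρ - σ) b) with h | h
        · rw [abs_of_nonneg h]; nlinarith
        · rw [abs_of_nonpos h]; nlinarith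
    _ = trDist (ρ - σ) := by
        rw [← Finset.mul_sum, Finset.sum_add_distrib, htr, add_zero, trDist]

lemma rank_upper {N : ℕ} {ρ : Matrix (Fin N) (Fin N) ℂ} (hρ : IsDensity ρ) (k : ℕ) (hk : k < N) :
    ∃ σ, IsDensity σ ∧
      trDist (ρ - σ) ≤ (∑ i : Fin N, if (i : ℕ) < k then eigAsc ρ i else 0) ∧
      σ.rank ≤ N - k := by
  classical
  obtain ⟨U, -, hU, hUs⟩ := eigAsc_spectral hρ.1.isHermitian
  have f0 := eigAsc_nonneg hρ.1
  have fs : ∑ i, eigAsc ρ i = 1 := by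
    have := sum_eigAsc hρ.1.isHermitian
    rw [hρ.2] at this
    exact_mod_cast this.symm
  set f := eigAsc ρ with hf
  set s := (∑ i : Fin N, if (i : ℕ) < k then f i else 0) with hs
  have s0 : 0 ≤ s := Finset.sum_nonneg fun i _ => by split_ifs <;> simp [f0]
  set l : Fin N := ⟨N - 1, by omega⟩ with hl
  set d : Fin N → ℝ := fun i => (if (i : ℕ) < k then 0 else f i) + (if i = l then s else 0) with hd
  have d0 : ∀ i, 0 ≤ d i := fun i => by
    simp only [hd]
    refine add_nonneg ?_ ?_
    · split_ifs <;> simp [f0]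
    · split_ifs <;> simp [s0]
  have ds : ∑ i, d i = 1 := by
    simp only [hd]
    rw [Finset.sum_add_distrib, Finset.sum_ite_eq' Finset.univ l (fun _ => s)]
    simp only [Finset.mem_univ, if_true]
    rw [hs, ← Finset.sum_add_distrib, ← fs]
    refine Finset.sum_congr rfl fun i _ => ?_
    split_ifs <;> simp
  refine ⟨U * diagonal (fun i => (d i : ℂ)) * Uᴴ, ⟨?_, ?_⟩, ?_, ?_⟩
  · apply PosSemidef.mul_mul_conjTranspose_same
    rw [posSemidef_diagonal_iff]
    intro i
    exact_mod_cast d0 i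
  · rw [trace_conj_diag hU, ds]; simp
  · have : ρ - U * diagonal (fun i => (d i : ℂ)) * Uᴴ
        = U * diagonal (fun i => ((f i - d i : ℝ) : ℂ)) * Uᴴ := by
      conv_lhs => rw [hUs]
      rw [← sub_mul, ← mul_sub, diagonal_sub]
      congr 3
      funext i
      push_cast
      rfl
    rw [this]
    refine (trDist_le hU _).trans ?_
    have : ∑ i, |f i - d i| ≤ ∑ i : Fin N, ((if (i : ℕ) < k then f i else 0) + (if i = l then s else 0)) := by
      refine Finset.sum_le_sum fun i _ => ?_
      have e : f i - d i = (if (i : ℕ) < k then f i else 0) - (if i = l then s else 0) := by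
        simp only [hd]; split_ifs <;> ring
      rw [e]
      refine (abs_sub _ _).trans (le_of_eq ?_)
      congr 1
      · apply abs_of_nonneg; split_ifs <;> simp [f0]
      · apply abs_of_nonneg; split_ifs <;> simp [s0]
    rw [Finset.sum_add_distrib, Finset.sum_ite_eq' Finset.univ l (fun _ => s)] at this
    simp only [Finset.mem_univ, if_true] at this
    rw [← hs] at this
    linarith
  · rw [rank_conj_diag hU]
    have hsub : Finset.univ.filter (fun i => d i ≠ 0) ⊆
        Finset.univ.filter (fun i : Fin N => ¬ (i : ℕ) < k) := by
      intro i hi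
      simp only [Finset.mem_filter, Finset.mem_univ, true_and] at hi ⊢
      intro hik
      apply hi
      have : i ≠ l := by
        intro h
        rw [h, hl] at hik
        simp at hik
        omega
      simp [hd, hik, this]
    refine (Finset.card_le_card hsub).trans ?_
    have h1 := Finset.card_filter_add_card_filter_not (s := (Finset.univ : Finset (Fin N)))
      (fun i : Fin N => (i : ℕ) < k)
    have h2 : (Finset.univ.filter (fun i : Fin N => (i : ℕ) < k)).card = k := by
      rw [Fin.card_filter_val_lt]; omega
    simp only [Finset.card_univ, Fintype.card_fin] at h1
    omega

/-- If `k` is the largest integer `j ≤ N` such that the sum of the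
`j` smallest eigenvalues of the density matrix ρ is at most ε, then the minimal rank of
a density matrix in the trace-distance ε-ball around ρ is `N - k`; equivalently
`S_0^ε(ρ) = log₂ (N - k)`. -/
theorem stmt13 {N : ℕ} (ρ : Matrix (Fin N) (Fin N) ℂ) (hρ : IsDensity ρ)
    (ε : ℝ) (hε0 : 0 ≤ ε) (hε1 : ε < 1) (k : ℕ) (hkN : k ≤ N)
    (hk : (∑ i : Fin N, if (i : ℕ) < k then eigAsc ρ i else 0) ≤ ε)
    (hkmax : ∀ j ≤ N, (∑ i : Fin N, if (i : ℕ) < j then eigAsc ρ i else 0) ≤ ε → j ≤ k) :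
    sInf {r : ℕ | ∃ σ, IsDensity σ ∧ trDist (ρ - σ) ≤ ε ∧ σ.rank = r} = N - k ∧
    Real.logb 2 (sInf {r : ℕ | ∃ σ, IsDensity σ ∧ trDist (ρ - σ) ≤ ε ∧ σ.rank = r} : ℕ) =
      Real.logb 2 ((N : ℝ) - (k : ℝ)) := by
  have fs : ∑ i, eigAsc ρ i = 1 := by
    have := sum_eigAsc hρ.1.isHermitian
    rw [hρ.2] at this
    exact_mod_cast this.symm
  have hlt : k < N := by
    rcases lt_or_eq_of_le hkN with h | h
    · exact h
    · exfalso
      subst h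
      simp only [Fin.is_lt, if_true] at hk
      linarith
  have low : ∀ σ, IsDensity σ → trDist (ρ - σ) ≤ ε → N - k ≤ σ.rank := by
    intro σ h1 h2
    have := hkmax (N - σ.rank) (Nat.sub_le _ _) ((rank_lower hρ h1).trans h2)
    omega
  have main : sInf {r : ℕ | ∃ σ, IsDensity σ ∧ trDist (ρ - σ) ≤ ε ∧ σ.rank = r} = N - k := by
    obtain ⟨σ, h1, h2, h3⟩ := rank_upper hρ k hlt
    have h2' := h2.trans hk
    have hr : σ.rank = N - k := le_antisymm h3 (low σ h1 h2')
    have hmem : N - k ∈ {r : ℕ | ∃ σ, IsDensity σ ∧ trDist (ρ - σ) ≤ ε ∧ σ.rank = r} :=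
      ⟨σ, h1, h2', hr⟩
    refine le_antisymm (Nat.sInf_le hmem) ?_
    refine le_csInf ⟨_, hmem⟩ ?_
    rintro r ⟨τ, t1, t2, rfl⟩
    exact low τ t1 t2
  refine ⟨main, ?_⟩
  rw [main, Nat.cast_sub hkN]
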